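/- If a sequence of real-valued random variables (x_1, x_2, ...) is infinitely exchangeable (every finite joint distribution is invariant under permutation of indices), then for all n the joint law p(x_1,...,x_n) admits a representation as an integral ∫ ∏_{i=1}^n p(x_i|θ) P(dθ) for some probability measure P on a parameter space; conversely any such mixture of i.i.d. laws is infinitely exchangeable. -/

import Mathlib

open MeasureTheory

namespace DeFinetti

open ProbabilityTheory Set
open scoped ENNReal

/-- Finite measures on a sequence space agree as soon as the laws of all initial segments agree. -/
theorem ext_of_map_initial {E : Type*} [MeasurableSpace E] {μ ν : Measure (ℕ → E)}
    [IsFiniteMeasure μ]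
    (h : ∀ n : ℕ, μ.map (fun ω (i : Fin n) => ω i) = ν.map (fun ω (i : Fin n) => ω i)) :
    μ = ν := by
  refine IsProjectiveLimit.unique (P := fun J => μ.map J.restrict) (fun J => rfl) (fun J => ?_)
  obtain ⟨n, hn⟩ := J.exists_nat_subset_range
  let f : (Fin n → E) → (J → E) := fun y j => y ⟨j, Finset.mem_range.1 (hn j.2)⟩
  have hf : Measurable f := by fun_prop
  have key : ∀ ρ : Measure (ℕ → E),
      ρ.map J.restrict = (ρ.map (fun ω (i : Fin n) => ω i)).map f := by
    intro ρ
    rw [Measure.map_map hf (by fun_prop)]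
    rfl
  exact (key ν).trans ((congrArg (Measure.map f) (h n).symm).trans (key μ).symm)

/-- The law of an infinitely exchangeable sequence is invariant under every injective
reindexing. -/
theorem measurePreserving_comp_injective {E : Type*} [MeasurableSpace E] {μ : Measure (ℕ → E)}
    [IsFiniteMeasure μ]
    (h : ∀ (n : ℕ) (π : Equiv.Perm (Fin n)),
      μ.map (fun ω (i : Fin n) => ω (π i)) = μ.map (fun ω (i : Fin n) => ω i))
    {σ : ℕ → ℕ} (hσ : Function.Injective σ) :
    MeasurePreserving (fun (ω : ℕ → E) k => ω (σ k)) μ μ := by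
  have hm : Measurable (fun (ω : ℕ → E) k => ω (σ k)) := by fun_prop
  refine ⟨hm, (ext_of_map_initial fun n => ?_).symm⟩
  obtain ⟨N, hN⟩ := ((Finset.range n).image σ ∪ Finset.range n).exists_nat_subset_range
  have hi : ∀ i : Fin n, (i : ℕ) < N := fun i =>
    Finset.mem_range.1 (hN (Finset.mem_union_right _ (Finset.mem_range.2 i.2)))
  have hσi : ∀ i : Fin n, σ i < N := fun i =>
    Finset.mem_range.1 (hN (Finset.mem_union_left _
      (Finset.mem_image_of_mem _ (Finset.mem_range.2 i.2))))
  obtain ⟨π, hπ⟩ := Equiv.Perm.exists_extending_pair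
    (fun i : Fin n => (⟨i, hi i⟩ : Fin N)) (fun i : Fin n => (⟨σ i, hσi i⟩ : Fin N))
    (fun i j hij => Fin.ext (by simpa using hij))
    (fun i j hij => Fin.ext (hσ (by simpa using hij)))
  let f : (Fin N → E) → (Fin n → E) := fun y i => y ⟨i, hi i⟩
  have hf : Measurable f := by fun_prop
  have hN := congrArg (Measure.map f) (h N π)
  rw [Measure.map_map hf (by fun_prop), Measure.map_map hf (by fun_prop)] at hN
  rw [Measure.map_map (by fun_prop) hm]
  have hcomp : (f ∘ fun (ω : ℕ → E) (i : Fin N) => ω (π i))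
      = (fun (ω : ℕ → E) (i : Fin n) => ω i) ∘ fun ω k => ω (σ k) := by
    funext ω i
    simp [f, hπ]
  rw [← hcomp, hN]
  rfl

/-- Equality in the Cauchy–Schwarz inequality for functions with values in `[0, 1]`. -/
theorem ae_eq_of_lintegral_mul_eq {α : Type*} [MeasurableSpace α] {μ : Measure α}
    [IsFiniteMeasure μ] {f g : α → ℝ≥0∞} (hf : Measurable f) (hg : Measurable g)
    (hf1 : ∀ a, f a ≤ 1) (hg1 : ∀ a, g a ≤ 1)
    (hff : ∫⁻ a, f a * f a ∂μ = ∫⁻ a, f a * g a ∂μ)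
    (hgg : ∫⁻ a, g a * g a ∂μ = ∫⁻ a, f a * g a ∂μ) : f =ᵐ[μ] g := by
  have hprod : ∀ {u v : α → ℝ≥0∞}, Measurable u → Measurable v → (∀ a, u a ≤ 1) →
      (∀ a, v a ≤ 1) → Integrable (fun a => (u a * v a).toReal) μ ∧
        ∫ a, (u a * v a).toReal ∂μ = (∫⁻ a, u a * v a ∂μ).toReal := by
    intro u v hu hv hu1 hv1
    have hle : ∀ a, u a * v a ≤ 1 := fun a => mul_le_one' (hu1 a) (hv1 a)
    refine ⟨Integrable.of_bound (hu.mul hv).ennreal_toReal.aestronglyMeasurable 1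
      (.of_forall fun a => ?_), integral_toReal (hu.mul hv).aemeasurable
        (.of_forall fun a => (hle a).trans_lt ENNReal.one_lt_top)⟩
    rw [Real.norm_of_nonneg ENNReal.toReal_nonneg]
    exact ENNReal.toReal_le_of_le_ofReal zero_le_one (by simpa using hle a)
  obtain ⟨iff, eff⟩ := hprod hf hf hf1 hf1
  obtain ⟨ifg, efg⟩ := hprod hf hg hf1 hg1
  obtain ⟨igg, egg⟩ := hprod hg hg hg1 hg1
  have hsq : ∀ a, ((f a).toReal - (g a).toReal) ^ 2
      = (f a * f a).toReal - 2 * (f a * g a).toReal + (g a * g a).toReal := by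
    intro a
    simp only [ENNReal.toReal_mul]
    ring
  have hzero : ∫ a, ((f a).toReal - (g a).toReal) ^ 2 ∂μ = 0 := by
    simp_rw [hsq]
    rw [integral_add (by exact iff.sub (ifg.const_mul 2)) igg, integral_sub iff (ifg.const_mul 2),
      integral_const_mul, eff, efg, egg, hff, hgg]
    ring
  have hae := (integral_eq_zero_iff_of_nonneg (fun a => sq_nonneg _)
    (by simp_rw [hsq]; exact (iff.sub (ifg.const_mul 2)).add igg)).1 hzero
  filter_upwards [hae] with a ha
  exact (ENNReal.toReal_eq_toReal_iff' ((hf1 a).trans_lt ENNReal.one_lt_top).ne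
    ((hg1 a).trans_lt ENNReal.one_lt_top).ne).1
      (sub_eq_zero.1 (pow_eq_zero_iff two_ne_zero |>.1 ha))

/-- The left shift on sequences. -/
def shift {E : Type*} (ω : ℕ → E) : ℕ → E := fun k => ω (k + 1)

theorem measurable_shift {E : Type*} [MeasurableSpace E] :
    Measurable (shift : (ℕ → E) → ℕ → E) := by
  unfold shift
  fun_prop

section Directing

variable {E : Type*} [MeasurableSpace E] [StandardBorelSpace E] [Nonempty E]

/-- The directing measure: the conditional law of the first term given the later ones. -/
noncomputable def directing (μ : Measure (ℕ → E)) [IsFiniteMeasure μ] : Kernel (ℕ → E) E :=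
  condDistrib (fun ω : ℕ → E => ω 0) shift μ

instance (μ : Measure (ℕ → E)) [IsFiniteMeasure μ] : IsMarkovKernel (directing μ) := by
  unfold directing
  infer_instance

variable {μ : Measure (ℕ → E)} [IsFiniteMeasure μ]

theorem lintegral_indicator_mul_shift (hshift : MeasurePreserving shift μ μ) {B : Set E}
    (hB : MeasurableSet B) {Φ : (ℕ → E) → ℝ≥0∞} (hΦ : Measurable Φ) :
    ∫⁻ ω, B.indicator 1 (ω 0) * Φ (shift ω) ∂μ = ∫⁻ ω, directing μ ω B * Φ ω ∂μ := by
  have hF : Measurable fun p : (ℕ → E) × E => B.indicator (1 : E → ℝ≥0∞) p.2 * Φ p.1 :=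
    ((measurable_one.indicator hB).comp measurable_snd).mul (hΦ.comp measurable_fst)
  have hdis := compProd_map_condDistrib (mβ := MeasurableSpace.pi) (X := shift) (μ := μ)
    (measurable_pi_apply (X := fun _ : ℕ => E) 0).aemeasurable
  rw [hshift.map_eq] at hdis
  have h := lintegral_map (μ := μ) hF
    (measurable_shift.prodMk (measurable_pi_apply (X := fun _ : ℕ => E) 0))
  rw [← h, ← hdis, Measure.lintegral_compProd hF]
  refine lintegral_congr fun ω => ?_
  dsimp only
  rw [lintegral_mul_const _ (measurable_one.indicator hB), lintegral_indicator_one hB]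
  rfl

theorem directing_shift_ae_eq
    (h : ∀ σ : ℕ → ℕ, Function.Injective σ →
      MeasurePreserving (fun (ω : ℕ → E) k => ω (σ k)) μ μ)
    {B : Set E} (hB : MeasurableSet B) :
    (fun ω => directing μ (shift ω) B) =ᵐ[μ] fun ω => directing μ ω B := by
  have hshift : MeasurePreserving shift μ μ := h Nat.succ Nat.succ_injective
  have hG : Measurable fun ω => directing μ ω B := (directing μ).measurable_coe hB
  have hGs := hG.comp measurable_shift
  have hcross : ∫⁻ ω, directing μ (shift ω) B * directing μ ω B ∂μ
      = ∫⁻ ω, directing μ ω B * directing μ ω B ∂μ := by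
    have hskip : Function.Injective fun k : ℕ => if k = 0 then 0 else k + 1 := by
      intro a b hab
      dsimp only at hab
      split_ifs at hab <;> omega
    calc ∫⁻ ω, directing μ (shift ω) B * directing μ ω B ∂μ
        = ∫⁻ ω, directing μ ω B * directing μ (shift ω) B ∂μ := by simp_rw [mul_comm]
      _ = ∫⁻ ω, B.indicator 1 (ω 0) * directing μ (shift (shift ω)) B ∂μ :=
          (lintegral_indicator_mul_shift hshift hB hGs).symm
      _ = ∫⁻ ω, B.indicator 1 (ω 0) * directing μ (shift ω) B ∂μ :=
          (h _ hskip).lintegral_comp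
            (f := fun ω => B.indicator (1 : E → ℝ≥0∞) (ω 0) * directing μ (shift ω) B)
            (((measurable_one.indicator hB).comp (measurable_pi_apply 0)).mul hGs)
      _ = ∫⁻ ω, directing μ ω B * directing μ ω B ∂μ :=
          lintegral_indicator_mul_shift hshift hB hG
  refine ae_eq_of_lintegral_mul_eq hGs hG (fun _ => prob_le_one) (fun _ => prob_le_one) ?_
    hcross.symm
  rw [hcross]
  exact hshift.lintegral_comp (hG.mul hG)

theorem lintegral_mul_prod_indicator
    (h : ∀ σ : ℕ → ℕ, Function.Injective σ →
      MeasurePreserving (fun (ω : ℕ → E) k => ω (σ k)) μ μ)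
    {n : ℕ} {B : Fin n → Set E} (hB : ∀ i, MeasurableSet (B i)) {g : (ℕ → E) → ℝ≥0∞}
    (hg : Measurable g) (hgs : (fun ω => g (shift ω)) =ᵐ[μ] g) :
    ∫⁻ ω, g ω * ∏ i, (B i).indicator 1 (ω i) ∂μ
      = ∫⁻ ω, g ω * ∏ i, directing μ ω (B i) ∂μ := by
  have hshift : MeasurePreserving shift μ μ := h Nat.succ Nat.succ_injective
  induction n generalizing g with
  | zero => simp
  | succ n ih =>
    have hG : Measurable fun ω => directing μ ω (B 0) := (directing μ).measurable_coe (hB 0)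
    let Φ : (ℕ → E) → ℝ≥0∞ := fun ω => g ω * ∏ i : Fin n, (B i.succ).indicator 1 (ω i)
    have hΦ : Measurable Φ := hg.mul (Finset.measurable_prod _ fun i _ =>
      (measurable_one.indicator (hB i.succ)).comp (measurable_pi_apply _))
    calc ∫⁻ ω, g ω * ∏ i, (B i).indicator 1 (ω i) ∂μ
        = ∫⁻ ω, (B 0).indicator 1 (ω 0) * Φ (shift ω) ∂μ := by
          refine lintegral_congr_ae ?_
          filter_upwards [hgs] with ω hω
          simp only [Φ, hω, Fin.prod_univ_succ, shift, Fin.val_zero, Fin.val_succ]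
          ring
      _ = ∫⁻ ω, directing μ ω (B 0) * Φ ω ∂μ := lintegral_indicator_mul_shift hshift (hB 0) hΦ
      _ = ∫⁻ ω, (g ω * directing μ ω (B 0)) * ∏ i : Fin n, (B i.succ).indicator 1 (ω i) ∂μ := by
          refine lintegral_congr fun ω => ?_
          simp only [Φ]
          ring
      _ = ∫⁻ ω, (g ω * directing μ ω (B 0)) * ∏ i : Fin n, directing μ ω (B i.succ) ∂μ :=
          ih (fun i => hB i.succ) (hg.mul hG) (hgs.mul (directing_shift_ae_eq h (hB 0)))
      _ = ∫⁻ ω, g ω * ∏ i, directing μ ω (B i) ∂μ := by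
          simp_rw [Fin.prod_univ_succ, mul_assoc]

end Directing

theorem measurable_pi_kernel {Θ E : Type*} [MeasurableSpace Θ] [MeasurableSpace E]
    (κ : Kernel Θ E) [IsMarkovKernel κ] (n : ℕ) :
    Measurable fun θ => Measure.pi fun _ : Fin n => κ θ := by
  refine Measurable.measure_of_isPiSystem_of_isProbabilityMeasure generateFrom_pi.symm
    isPiSystem_pi ?_
  rintro _ ⟨B, hB, rfl⟩
  simp_rw [Measure.pi_pi]
  exact Finset.measurable_prod _ fun i _ => κ.measurable_coe (hB i (mem_univ i))

/-- The initial segments of an infinitely exchangeable sequence are mixtures of the powers of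
its directing measure. -/
theorem map_initial_eq_bind {E : Type*} [MeasurableSpace E] [StandardBorelSpace E] [Nonempty E]
    {μ : Measure (ℕ → E)} [IsProbabilityMeasure μ]
    (h : ∀ (n : ℕ) (π : Equiv.Perm (Fin n)),
      μ.map (fun ω (i : Fin n) => ω (π i)) = μ.map (fun ω (i : Fin n) => ω i)) (n : ℕ) :
    μ.map (fun ω (i : Fin n) => ω i)
      = μ.bind fun θ => Measure.pi fun _ : Fin n => directing μ θ := by
  have hκ := measurable_pi_kernel (directing μ) n
  have hm : Measurable fun (ω : ℕ → E) (i : Fin n) => ω i := by fun_prop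
  have := Measure.isProbabilityMeasure_map (μ := μ) hm.aemeasurable
  refine ext_of_generate_finite _ generateFrom_pi.symm isPiSystem_pi ?_ ?_
  · rintro _ ⟨B, hB, rfl⟩
    replace hB : ∀ i, MeasurableSet (B i) := fun i => hB i (mem_univ i)
    have hpi := MeasurableSet.univ_pi hB
    have hmain := lintegral_mul_prod_indicator
      (fun σ hσ => measurePreserving_comp_injective h hσ) hB
      (measurable_const (a := (1 : ℝ≥0∞))) (.of_forall fun _ => rfl)
    simp only [one_mul] at hmain
    rw [Measure.bind_apply hpi hκ.aemeasurable, ← lintegral_indicator_one hpi,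
      lintegral_map (measurable_one.indicator hpi) hm]
    simp_rw [Measure.pi_pi, ← hmain]
    refine lintegral_congr fun ω => ?_
    by_cases hω : ∀ i : Fin n, ω i ∈ B i
    · rw [indicator_of_mem (by simpa using hω)]
      simp [hω]
    · rw [indicator_of_notMem (by simpa using hω)]
      obtain ⟨i, hi⟩ := not_forall.1 hω
      exact (Finset.prod_eq_zero (Finset.mem_univ i) (indicator_of_notMem hi _)).symm
  · rw [Measure.bind_apply MeasurableSet.univ hκ.aemeasurable]
    simp

end DeFinetti

/-- De Finetti's representation theorem: a sequence of real-valued random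
variables is infinitely exchangeable (every finite joint law is invariant under
permutation of the indices) if and only if, for every `n`, the joint law of
`(x 0, …, x (n-1))` is a mixture over some parameter space `Θ` (with a
probability measure `P`) of i.i.d. product laws `∏ᵢ q θ`. -/
theorem stmt_0 {Ω : Type*} [MeasurableSpace Ω] (ℙ : Measure Ω)
    [IsProbabilityMeasure ℙ] (x : ℕ → Ω → ℝ) (hx : ∀ i, Measurable (x i)) :
    (∀ (n : ℕ) (π : Equiv.Perm (Fin n)),
        Measure.map (fun ω (i : Fin n) => x (π i) ω) ℙ
          = Measure.map (fun ω (i : Fin n) => x i ω) ℙ)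
      ↔ ∃ (Θ : Type) (_ : MeasurableSpace Θ) (P : Measure Θ)
          (q : Θ → Measure ℝ), IsProbabilityMeasure P
          ∧ (∀ θ, IsProbabilityMeasure (q θ))
          ∧ ∀ (n : ℕ) (s : Set (Fin n → ℝ)), MeasurableSet s →
              Measure.map (fun ω (i : Fin n) => x i ω) ℙ s
                = ∫⁻ θ, Measure.pi (fun _ : Fin n => q θ) s ∂P := by
  constructor
  · intro h
    have hX : Measurable fun ω k => x k ω := measurable_pi_lambda _ hx
    let μ : Measure (ℕ → ℝ) := ℙ.map fun ω k => x k ω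
    have hμ : IsProbabilityMeasure μ := Measure.isProbabilityMeasure_map hX.aemeasurable
    have hmap : ∀ (n : ℕ) (τ : Fin n → ℕ),
        μ.map (fun ω i => ω (τ i)) = ℙ.map fun ω i => x (τ i) ω := fun n τ =>
      Measure.map_map (by fun_prop) hX
    have hexch : ∀ (n : ℕ) (π : Equiv.Perm (Fin n)),
        μ.map (fun ω (i : Fin n) => ω (π i)) = μ.map (fun ω (i : Fin n) => ω i) := by
      intro n π
      rw [hmap n fun i => π i, hmap n fun i => i]
      exact h n π
    refine ⟨ℕ → ℝ, inferInstance, μ, fun θ => DeFinetti.directing μ θ, hμ,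
      fun θ => inferInstance, fun n s hs => ?_⟩
    rw [← hmap n fun i => i, DeFinetti.map_initial_eq_bind hexch n,
      Measure.bind_apply hs (DeFinetti.measurable_pi_kernel _ n).aemeasurable]
  · rintro ⟨Θ, _, P, q, _, hq, h⟩ n π
    have hperm : Measurable fun (y : Fin n → ℝ) i => y (π i) := by fun_prop
    have hX : Measurable fun ω (i : Fin n) => x i ω := measurable_pi_lambda _ fun i => hx i
    have hcomp : ℙ.map (fun ω (i : Fin n) => x (π i) ω)
        = (ℙ.map fun ω (i : Fin n) => x i ω).map fun y i => y (π i) :=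
      (Measure.map_map hperm hX).symm
    have hpi : ∀ θ, (Measure.pi fun _ : Fin n => q θ).map (fun y i => y (π i))
        = Measure.pi fun _ : Fin n => q θ := by
      intro θ
      refine (Measure.pi_eq fun B hB => ?_).symm
      have hpre : (fun (y : Fin n → ℝ) i => y (π i)) ⁻¹' Set.univ.pi B
          = Set.univ.pi fun i => B (π.symm i) := by
        ext y
        simp only [Set.mem_preimage, Set.mem_univ_pi]
        exact ⟨fun hy i => by simpa using hy (π.symm i), fun hy i => by simpa using hy (π i)⟩
      rw [Measure.map_apply hperm (MeasurableSet.univ_pi hB), hpre, Measure.pi_pi]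
      exact Equiv.prod_comp π.symm fun i => q θ (B i)
    ext s hs
    rw [hcomp, Measure.map_apply hperm hs, h n _ (hperm hs), h n s hs]
    refine lintegral_congr fun θ => ?_
    rw [← Measure.map_apply hperm hs, hpi]
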